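/- arXiv:2308.15806 — 6 statements merged into one kernel-verified Lean document; each statement's English description precedes it below -/
import Mathlib

section
/- Let n, m ≥ 1, A ∈ ℝ^{n×n}, B ∈ ℝ^{n×m}, let Q ∈ ℝ^{n×n} be symmetric positive semidefinite with positive semidefinite square root Q^{1/2}, and let R ∈ ℝ^{m×m} be symmetric positive definite. Assume (A, B) is stabilizable, i.e., there exists F ∈ ℝ^{m×n} such that A − B·F is Hurwitz, and (A, Q^{1/2}) is detectable, i.e., there exists G ∈ ℝ^{n×n} such that A − G·Q^{1/2} is Hurwitz. If P ∈ ℝ^{n×n} is symmetric positive definite and satisfies the algebraic Riccati equation AᵀP + PA − P·B·R⁻¹·Bᵀ·P + Q = 0, then the closed-loop matrix A − B·R⁻¹·Bᵀ·P is Hurwitz. -/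
open Matrix

/-- A real square matrix is Hurwitz if every complex root of its characteristic
polynomial has strictly negative real part. -/
def IsHurwitz {ι : Type*} [Fintype ι] [DecidableEq ι] (M : Matrix ι ι ℝ) : Prop :=
  ∀ z : ℂ, (M.charpoly.map (algebraMap ℝ ℂ)).IsRoot z → z.re < 0

/-- A real matrix is Hurwitz iff every pair of real and imaginary parts of a complex eigenvector
belongs to an eigenvalue with negative real part. -/
theorem isHurwitz_iff_re_im {ι : Type*} [Fintype ι] [DecidableEq ι] (M : Matrix ι ι ℝ) :
    IsHurwitz M ↔ ∀ (a b : ℝ) (x y : ι → ℝ), (x ≠ 0 ∨ y ≠ 0) →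
      M *ᵥ x = a • x - b • y → M *ᵥ y = b • x + a • y → a < 0 := by
  have key : ∀ z : ℂ, (M.charpoly.map (algebraMap ℝ ℂ)).IsRoot z ↔
      ∃ v : ι → ℂ, v ≠ 0 ∧ (M.map (algebraMap ℝ ℂ)) *ᵥ v = z • v := by
    intro z
    rw [← Matrix.charpoly_map, Polynomial.IsRoot.def, Matrix.eval_charpoly,
      ← Matrix.exists_mulVec_eq_zero_iff]
    simp only [Matrix.sub_mulVec, sub_eq_zero, Matrix.scalar_apply,
      ← Matrix.smul_one_eq_diagonal, Matrix.smul_mulVec, Matrix.one_mulVec]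
    exact exists_congr fun v => and_congr_right fun _ => eq_comm
  have parts : ∀ (v : ι → ℂ) (i : ι),
      ((M.map (algebraMap ℝ ℂ)) *ᵥ v) i =
        ⟨(M *ᵥ fun j => (v j).re) i, (M *ᵥ fun j => (v j).im) i⟩ := by
    intro v i
    apply Complex.ext <;> simp [Matrix.mulVec, dotProduct]
  constructor
  · intro h a b x y hxy hx hy
    refine h ⟨a, b⟩ ((key _).2 ⟨fun j => ⟨x j, y j⟩, ?_, ?_⟩)
    · intro h0
      have hx0 : x = 0 := funext fun j => congrArg Complex.re (congrFun h0 j)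
      have hy0 : y = 0 := funext fun j => congrArg Complex.im (congrFun h0 j)
      tauto
    · funext i
      rw [parts]
      apply Complex.ext
      · simpa using congrFun hx i
      · simpa [add_comm] using congrFun hy i
  · intro h z hz
    obtain ⟨v, hv, hMv⟩ := (key z).1 hz
    refine h z.re z.im (fun j => (v j).re) (fun j => (v j).im) ?_ ?_ ?_
    · by_contra! h0
      exact hv (funext fun j => Complex.ext (congrFun h0.1 j) (congrFun h0.2 j))
    · funext i
      have := congrArg Complex.re ((parts v i).symm.trans (congrFun hMv i))
      simpa using this
    · funext i
      have := congrArg Complex.im ((parts v i).symm.trans (congrFun hMv i))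
      simpa [add_comm] using this

theorem stmt0 {n m : ℕ} (hn : 1 ≤ n) (hm : 1 ≤ m)
    (A : Matrix (Fin n) (Fin n) ℝ) (B : Matrix (Fin n) (Fin m) ℝ)
    (Q Qhalf : Matrix (Fin n) (Fin n) ℝ) (R : Matrix (Fin m) (Fin m) ℝ)
    (hQ : Q.PosSemidef) (hQhalf : Qhalf.PosSemidef) (hQhalf_sq : Qhalf * Qhalf = Q)
    (hR : R.PosDef)
    (hstab : ∃ F : Matrix (Fin m) (Fin n) ℝ, IsHurwitz (A - B * F))
    (hdet : ∃ G : Matrix (Fin n) (Fin n) ℝ, IsHurwitz (A - G * Qhalf))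
    (P : Matrix (Fin n) (Fin n) ℝ) (hP : P.PosDef)
    (hRiccati : Aᵀ * P + P * A - P * B * R⁻¹ * Bᵀ * P + Q = 0) :
    IsHurwitz (A - B * (R⁻¹ * Bᵀ * P)) := by
  rw [isHurwitz_iff_re_im]
  intro a b x y hxy hx hy
  by_contra! ha
  obtain ⟨G, hG⟩ := hdet
  rw [isHurwitz_iff_re_im] at hG
  have hPt : Pᵀ = P := by
    rw [← Matrix.conjTranspose_eq_transpose_of_trivial, hP.isHermitian.eq]
  have hQt : Qhalfᵀ = Qhalf := by
    rw [← Matrix.conjTranspose_eq_transpose_of_trivial, hQhalf.isHermitian.eq]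
  have lyapunov : ∀ u : Fin n → ℝ, 2 * (u ⬝ᵥ P *ᵥ ((A - B * (R⁻¹ * Bᵀ * P)) *ᵥ u)) =
      -((Bᵀ *ᵥ P *ᵥ u) ⬝ᵥ R⁻¹ *ᵥ (Bᵀ *ᵥ P *ᵥ u)) - (Qhalf *ᵥ u) ⬝ᵥ (Qhalf *ᵥ u) := by
    intro u
    have h := congrArg (fun N : Matrix (Fin n) (Fin n) ℝ => u ⬝ᵥ N *ᵥ u) hRiccati
    have hA : u ⬝ᵥ (Aᵀ *ᵥ P *ᵥ u) = u ⬝ᵥ (P *ᵥ A *ᵥ u) := by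
      rw [Matrix.dotProduct_mulVec, Matrix.vecMul_transpose, dotProduct_comm,
        Matrix.dotProduct_mulVec u, ← Matrix.mulVec_transpose, hPt]
    have hS : (Bᵀ *ᵥ P *ᵥ u) ⬝ᵥ R⁻¹ *ᵥ (Bᵀ *ᵥ P *ᵥ u) =
        u ⬝ᵥ (P *ᵥ B *ᵥ R⁻¹ *ᵥ (Bᵀ *ᵥ P *ᵥ u)) := by
      rw [Matrix.dotProduct_mulVec u, ← Matrix.mulVec_transpose, hPt,
        Matrix.dotProduct_mulVec (P *ᵥ u), ← Matrix.mulVec_transpose]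
    have hQu : (Qhalf *ᵥ u) ⬝ᵥ (Qhalf *ᵥ u) = u ⬝ᵥ (Qhalf *ᵥ Qhalf *ᵥ u) := by
      rw [Matrix.dotProduct_mulVec u, ← Matrix.mulVec_transpose, hQt]
    rw [hS, hQu]
    simp only [← hQhalf_sq, Matrix.add_mulVec, Matrix.sub_mulVec, ← Matrix.mulVec_mulVec,
      dotProduct_add, dotProduct_sub, Matrix.zero_mulVec, dotProduct_zero, hA] at h
    simp only [Matrix.sub_mulVec, Matrix.mulVec_sub, ← Matrix.mulVec_mulVec, dotProduct_sub]
    linarith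
  have hcross : x ⬝ᵥ P *ᵥ y = y ⬝ᵥ P *ᵥ x := by
    rw [Matrix.dotProduct_mulVec, ← Matrix.mulVec_transpose, hPt, dotProduct_comm]
  have lx := lyapunov x
  have ly := lyapunov y
  rw [hx] at lx
  rw [hy] at ly
  simp only [Matrix.mulVec_sub, Matrix.mulVec_add, Matrix.mulVec_smul, dotProduct_sub,
    dotProduct_add, dotProduct_smul, smul_eq_mul, hcross] at lx ly
  have hPnn : ∀ u, 0 ≤ u ⬝ᵥ P *ᵥ u := fun u => by
    simpa using hP.posSemidef.dotProduct_mulVec_nonneg u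
  have hRnn : ∀ u, 0 ≤ u ⬝ᵥ R⁻¹ *ᵥ u := fun u => by
    simpa using hR.inv.posSemidef.dotProduct_mulVec_nonneg u
  have hR0 : ∀ u, u ⬝ᵥ R⁻¹ *ᵥ u ≤ 0 → u = 0 := fun u hu => by
    by_contra hne
    have := hR.inv.dotProduct_mulVec_pos hne
    simp only [star_trivial] at this
    linarith
  have hnn : ∀ u : Fin n → ℝ, 0 ≤ u ⬝ᵥ u := fun u =>
    Finset.sum_nonneg fun i _ => mul_self_nonneg (u i)
  have hax := mul_nonneg ha (hPnn x)
  have hay := mul_nonneg ha (hPnn y)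
  have hBx := hRnn (Bᵀ *ᵥ P *ᵥ x)
  have hBy := hRnn (Bᵀ *ᵥ P *ᵥ y)
  have hQx := hnn (Qhalf *ᵥ x)
  have hQy := hnn (Qhalf *ᵥ y)
  have hBx0 : Bᵀ *ᵥ P *ᵥ x = 0 := hR0 _ (by linarith)
  have hBy0 : Bᵀ *ᵥ P *ᵥ y = 0 := hR0 _ (by linarith)
  have hQx0 : Qhalf *ᵥ x = 0 := dotProduct_self_eq_zero.1 (by linarith)
  have hQy0 : Qhalf *ᵥ y = 0 := dotProduct_self_eq_zero.1 (by linarith)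
  refine (hG a b x y hxy ?_ ?_).not_ge ha
  · rw [← hx]
    simp only [Matrix.sub_mulVec, ← Matrix.mulVec_mulVec, hBx0, hQx0, Matrix.mulVec_zero]
  · rw [← hy]
    simp only [Matrix.sub_mulVec, ← Matrix.mulVec_mulVec, hBy0, hQy0, Matrix.mulVec_zero]
end

section
/- Let n ≥ 1, A ∈ ℝ^{n×n} and C ∈ ℝ^{q×n}. The following are equivalent: (i) for every monic polynomial p ∈ ℝ[X] of degree n there exists L ∈ ℝ^{n×q} such that the characteristic polynomial of A − L·C equals p (i.e., the eigenvalues of A − L·C can be assigned to arbitrary locations); (ii) the pair (A, C) is observable. -/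
open Matrix Polynomial

/-- The pair `(A, C)` is observable if the only vector `v` with
`C * A ^ k * v = 0` for all `k < n` is `v = 0`. -/
def IsObservable {n q : ℕ} (A : Matrix (Fin n) (Fin n) ℝ)
    (C : Matrix (Fin q) (Fin n) ℝ) : Prop :=
  ∀ v : Fin n → ℝ, (∀ k < n, C.mulVec ((A ^ k).mulVec v) = 0) → v = 0

/-- If `C * A ^ k * v = 0` for all `k < n`, output injection does not change `A ^ k * v`
for `k ≤ n`. -/
lemma pow_sub_mul_mulVec_eq {n q : ℕ} {A : Matrix (Fin n) (Fin n) ℝ}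
    {C : Matrix (Fin q) (Fin n) ℝ} (L : Matrix (Fin n) (Fin q) ℝ) {v : Fin n → ℝ} {m : ℕ}
    (hv : ∀ k < m, C *ᵥ (A ^ k *ᵥ v) = 0) :
    ∀ k ≤ m, (A - L * C) ^ k *ᵥ v = A ^ k *ᵥ v := by
  intro k
  induction k with
  | zero => simp
  | succ k ih =>
    intro hk
    rw [pow_succ', ← mulVec_mulVec, ih (by omega), sub_mulVec, ← mulVec_mulVec, hv k (by omega),
      mulVec_zero, sub_zero, mulVec_mulVec, ← pow_succ']

lemma aeval_mulVec_eq_sum {n : ℕ} (M : Matrix (Fin n) (Fin n) ℝ) (p : ℝ[X]) (v : Fin n → ℝ) :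
    aeval M p *ᵥ v = ∑ k ∈ Finset.range (p.natDegree + 1), p.coeff k • (M ^ k *ᵥ v) := by
  rw [aeval_eq_sum_range, sum_mulVec]
  simp only [smul_mulVec]

lemma isObservable_of_forall_exists_charpoly_eq {n q : ℕ}
    {A : Matrix (Fin n) (Fin n) ℝ} {C : Matrix (Fin q) (Fin n) ℝ}
    (h : ∀ p : ℝ[X], p.Monic → p.natDegree = n →
      ∃ L : Matrix (Fin n) (Fin q) ℝ, (A - L * C).charpoly = p) :
    IsObservable A C := by
  intro v hv
  obtain ⟨c, hc⟩ : ∃ c, ¬ A.charpoly.IsRoot c := by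
    by_contra! hroot
    exact A.charpoly_monic.ne_zero (Polynomial.funext fun c => by simpa using hroot c)
  obtain ⟨L, hL⟩ := h ((X - Polynomial.C c) ^ n) ((monic_X_sub_C c).pow n) (by simp)
  have hdeg : ((X - Polynomial.C c) ^ n).natDegree = n := by simp
  have hzero : aeval A ((X - Polynomial.C c) ^ n) *ᵥ v = 0 := by
    have hCH : aeval (A - L * C) ((X - Polynomial.C c) ^ n) *ᵥ v = 0 := by
      rw [← hL, aeval_self_charpoly, zero_mulVec]
    rw [aeval_mulVec_eq_sum, hdeg] at hCH ⊢
    rw [← hCH]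
    refine Finset.sum_congr rfl fun k hk => ?_
    rw [pow_sub_mul_mulVec_eq L hv k (by simpa [Nat.lt_succ_iff] using hk)]
  have hunit : IsUnit (aeval A ((X - Polynomial.C c) ^ n)) := by
    rw [map_pow]
    refine IsUnit.pow n ?_
    rw [← IsUnit.neg_iff, isUnit_iff_isUnit_det, isUnit_iff_ne_zero]
    rw [IsRoot, eval_charpoly] at hc
    simpa [algebraMap_eq_diagonal, scalar_apply, Pi.algebraMap_def] using hc
  exact mulVec_injective_of_isUnit hunit (by rw [hzero, mulVec_zero])

/-- A subspace of row vectors that contains the rows of `C` and is invariant under `A` is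
everything, provided `(A, C)` is observable. -/
lemma IsObservable.eq_top_of_invariant {n q : ℕ} {A : Matrix (Fin n) (Fin n) ℝ}
    {C : Matrix (Fin q) (Fin n) ℝ} (h : IsObservable A C) (V : Submodule ℝ (Fin n → ℝ))
    (hC : ∀ w, w ᵥ* C ∈ V) (hA : ∀ x ∈ V, x ᵥ* A ∈ V) : V = ⊤ := by
  by_contra hV
  obtain ⟨f, hf, hle⟩ := V.exists_le_ker_of_lt_top (lt_top_iff_ne_top.2 hV)
  let v : Fin n → ℝ := fun i => f (Pi.single i 1)
  have hfv : ∀ x, f x = x ⬝ᵥ v := fun x => by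
    conv_lhs => rw [pi_eq_sum_univ' x]
    simp [v, dotProduct, map_sum]
  have hmem : ∀ k w, w ᵥ* C ᵥ* A ^ k ∈ V := by
    intro k w
    induction k with
    | zero => simpa using hC w
    | succ k ih => rw [pow_succ, ← vecMul_vecMul]; exact hA _ ih
  have hv : v = 0 := h v fun k _ => by
    refine dotProduct_eq_zero _ fun w => ?_
    rw [dotProduct_comm, dotProduct_mulVec, dotProduct_mulVec, ← hfv]
    exact hle (hmem k w)
  exact hf (LinearMap.ext fun x => by simp [hfv, hv])

/-- Heymann's sequence: rows `x i` that arise from each other by `A`, up to a correction in the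
row space of `C`, and that are linearly independent. -/
lemma IsObservable.exists_linearIndependent_rows {n q : ℕ} {A : Matrix (Fin n) (Fin n) ℝ}
    {C : Matrix (Fin q) (Fin n) ℝ} (h : IsObservable A C) {k : ℕ} (hk : k ≤ n) :
    ∃ (x : ℕ → Fin n → ℝ) (u : ℕ → Fin q → ℝ),
      LinearIndependent ℝ (fun i : Fin k => x i) ∧
      (0 < k → x 0 = u 0 ᵥ* C) ∧
      ∀ i, i + 1 < k → x (i + 1) = x i ᵥ* A + u (i + 1) ᵥ* C := by
  induction k with
  | zero => exact ⟨0, 0, linearIndependent_empty_type, by simp, by simp⟩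
  | succ k ih =>
    obtain ⟨x, u, hli, h0, hs⟩ := ih (by omega)
    let V := Submodule.span ℝ (Set.range fun i : Fin k => x i)
    have hxV : ∀ i < k, x i ∈ V := fun i hi => Submodule.subset_span ⟨⟨i, hi⟩, rfl⟩
    let y : Fin n → ℝ := if k = 0 then 0 else x (k - 1) ᵥ* A
    obtain ⟨w, hw⟩ : ∃ w, y + w ᵥ* C ∉ V := by
      by_contra! hall
      have hy : y ∈ V := by simpa using hall 0
      have hC : ∀ w, w ᵥ* C ∈ V := fun w => (V.add_mem_iff_right hy).1 (hall w)
      have htop : V = ⊤ := by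
        refine h.eq_top_of_invariant V hC fun z hz => ?_
        suffices V ≤ V.comap A.vecMulLinear from this hz
        refine Submodule.span_le.2 ?_
        rintro _ ⟨⟨i, hi⟩, rfl⟩
        change x i ᵥ* A ∈ V
        by_cases hik : i + 1 < k
        · rw [← V.add_mem_iff_left (hC (u (i + 1))), ← hs i hik]
          exact hxV _ hik
        · obtain rfl : k = i + 1 := by omega
          simpa [y] using hy
      have hrank : Module.finrank ℝ V = k := by
        simpa using finrank_span_eq_card hli
      rw [htop, finrank_top, Module.finrank_fin_fun] at hrank
      omega
    refine ⟨Function.update x k (y + w ᵥ* C), Function.update u k w, ?_, fun _ => ?_,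
      fun i hi => ?_⟩
    · rw [linearIndependent_finSucc']
      have hinit : (Fin.init fun i : Fin (k + 1) => Function.update x k (y + w ᵥ* C) i) =
          fun i : Fin k => x i := by
        funext i
        simp [Fin.init, Function.update_of_ne i.2.ne]
      rw [hinit]
      exact ⟨hli, by simpa using hw⟩
    · rcases Nat.eq_zero_or_pos k with rfl | hpos
      · simp [y]
      · simpa [Function.update_of_ne hpos.ne] using h0 hpos
    · rw [Function.update_of_ne (show i ≠ k by omega)]
      by_cases hik : i + 1 = k
      · subst hik
        simp [y]
      · rw [Function.update_of_ne hik, Function.update_of_ne hik]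
        exact hs i (by omega)

/-- An observable pair can be made observable through a single combination `u` of the outputs,
after output injection. -/
lemma IsObservable.exists_isUnit_single_output {n q : ℕ} {A : Matrix (Fin n) (Fin n) ℝ}
    {C : Matrix (Fin q) (Fin n) ℝ} (h : IsObservable A C) :
    ∃ (L : Matrix (Fin n) (Fin q) ℝ) (u : Fin q → ℝ),
      IsUnit (Matrix.of fun i : Fin n => u ᵥ* C ᵥ* (A - L * C) ^ (i : ℕ)) := by
  obtain ⟨x, u, hli, h0, hs⟩ := h.exists_linearIndependent_rows le_rfl
  let S : Matrix (Fin n) (Fin n) ℝ := Matrix.of fun i => x i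
  have hS : IsUnit S := linearIndependent_rows_iff_isUnit.1 hli
  let U : Matrix (Fin n) (Fin q) ℝ := Matrix.of fun i => -u (i + 1)
  let L := S⁻¹ * U
  have hSL : S * L = U := by
    rw [← Matrix.mul_assoc, mul_nonsing_inv _ ((isUnit_iff_isUnit_det _).1 hS), Matrix.one_mul]
  have hxL : ∀ i < n, x i ᵥ* L = -u (i + 1) := fun i hi => congrFun hSL ⟨i, hi⟩
  have hpow : ∀ i < n, u 0 ᵥ* C ᵥ* (A - L * C) ^ i = x i := by
    intro i
    induction i with
    | zero => intro hi; simp [h0 hi]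
    | succ i ih =>
      intro hi
      rw [pow_succ, ← vecMul_vecMul, ih (by omega), vecMul_sub, ← vecMul_vecMul,
        hxL i (by omega), neg_vecMul, sub_neg_eq_add, hs i hi]
  refine ⟨L, u 0, ?_⟩
  convert hS using 1
  ext i j
  exact congrFun (hpow i i.2) j

/-- A monic polynomial of degree `n` annihilating a cyclic vector is the characteristic
polynomial. -/
lemma charpoly_eq_of_aeval_mulVec_eq_zero {n : ℕ} (N : Matrix (Fin n) (Fin n) ℝ)
    (v : Fin n → ℝ) (hcyc : ∀ r : ℝ[X], r.natDegree < n → aeval N r *ᵥ v = 0 → r = 0)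
    {p : ℝ[X]} (hp : p.Monic) (hdeg : p.natDegree = n) (hv : aeval N p *ᵥ v = 0) :
    N.charpoly = p := by
  by_contra hne
  have hNdeg : N.charpoly.natDegree = n := by simp [charpoly_natDegree_eq_dim]
  have hlt : (N.charpoly - p).degree < N.charpoly.degree := by
    refine degree_sub_lt_left ?_ N.charpoly_monic.ne_zero ?_
    · rw [degree_eq_natDegree N.charpoly_monic.ne_zero, degree_eq_natDegree hp.ne_zero, hNdeg,
        hdeg]
    · rw [N.charpoly_monic.leadingCoeff, hp.leadingCoeff]
  refine hne (sub_eq_zero.1 (hcyc _ ?_ ?_))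
  · have := natDegree_lt_natDegree (sub_ne_zero.2 hne) hlt
    rwa [hNdeg] at this
  · rw [map_sub, sub_mulVec, hv, aeval_self_charpoly, zero_mulVec, sub_zero]

/-- Ackermann's formula for a single output `c`. -/
lemma charpoly_sub_vecMulVec_aeval {n : ℕ} (M : Matrix (Fin n) (Fin n) ℝ)
    (c v : Fin n → ℝ) (hlt : ∀ k, k + 1 < n → c ⬝ᵥ (M ^ k *ᵥ v) = 0)
    (hlast : c ⬝ᵥ (M ^ (n - 1) *ᵥ v) = 1)
    {p : ℝ[X]} (hp : p.Monic) (hdeg : p.natDegree = n) :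
    (M - vecMulVec (aeval M p *ᵥ v) c).charpoly = p := by
  have hn : n ≠ 0 := by
    rintro rfl
    simp at hlast
  set g := aeval M p *ᵥ v with hg
  set N := M - vecMulVec g c with hN
  have hNmul : ∀ z, N *ᵥ z = M *ᵥ z - (c ⬝ᵥ z) • g := by
    intro z
    rw [hN, sub_mulVec, vecMulVec_mulVec]
    simp
  have hpow : ∀ k < n, N ^ k *ᵥ v = M ^ k *ᵥ v := by
    intro k
    induction k with
    | zero => simp
    | succ k ih =>
      intro hk
      rw [pow_succ', ← mulVec_mulVec, ih (by omega), hNmul, hlt k hk, zero_smul, sub_zero,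
        mulVec_mulVec, ← pow_succ']
  have hpown : N ^ n *ᵥ v = M ^ n *ᵥ v - g := by
    have hsucc : ∀ B : Matrix (Fin n) (Fin n) ℝ, B ^ n = B * B ^ (n - 1) := fun B =>
      (mul_pow_sub_one hn B).symm
    rw [hsucc N, hsucc M, ← mulVec_mulVec, hpow _ (by omega), hNmul, hlast, one_smul,
      mulVec_mulVec]
  refine charpoly_eq_of_aeval_mulVec_eq_zero N v (fun r hr hrv => ?_) hp hdeg ?_
  · rw [aeval_mulVec_eq_sum] at hrv
    have happ := congrArg (fun z => c ⬝ᵥ (M ^ (n - 1 - r.natDegree) *ᵥ z)) hrv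
    simp only [mulVec_sum, dotProduct_sum, mulVec_smul, dotProduct_smul, mulVec_zero,
      dotProduct_zero] at happ
    rw [Finset.sum_range_succ, Finset.sum_eq_zero, zero_add, hpow _ hr, mulVec_mulVec, ← pow_add,
      Nat.sub_add_cancel (by omega), hlast, smul_eq_mul, mul_one] at happ
    · exact leadingCoeff_eq_zero.1 happ
    · intro k hk
      have hk' := Finset.mem_range.1 hk
      rw [hpow k (by omega), mulVec_mulVec, ← pow_add, hlt _ (by omega), smul_zero]
  · have hsum : g = ∑ k ∈ Finset.range (n + 1), p.coeff k • (M ^ k *ᵥ v) := by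
      rw [hg, aeval_mulVec_eq_sum, hdeg]
    have hcoeff : p.coeff n = 1 := hdeg ▸ hp.coeff_natDegree
    rw [Finset.sum_range_succ, hcoeff, one_smul] at hsum
    rw [aeval_mulVec_eq_sum, hdeg, Finset.sum_range_succ, hcoeff, one_smul, hpown,
      Finset.sum_congr rfl fun k hk => by rw [hpow k (Finset.mem_range.1 hk)]]
    rw [← add_sub_assoc, ← hsum, sub_self]

lemma IsObservable.exists_charpoly_eq {n q : ℕ} {A : Matrix (Fin n) (Fin n) ℝ}
    {C : Matrix (Fin q) (Fin n) ℝ} (h : IsObservable A C) (hn : 1 ≤ n)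
    {p : ℝ[X]} (hp : p.Monic) (hdeg : p.natDegree = n) :
    ∃ L : Matrix (Fin n) (Fin q) ℝ, (A - L * C).charpoly = p := by
  obtain ⟨L, u, hS⟩ := h.exists_isUnit_single_output
  set M := A - L * C with hM
  set S : Matrix (Fin n) (Fin n) ℝ := Matrix.of fun i : Fin n => u ᵥ* C ᵥ* M ^ (i : ℕ) with hSdef
  let v := S⁻¹ *ᵥ Pi.single (⟨n - 1, by omega⟩ : Fin n) (1 : ℝ)
  have hSv : S *ᵥ v = Pi.single (⟨n - 1, by omega⟩ : Fin n) (1 : ℝ) := by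
    rw [mulVec_mulVec, mul_nonsing_inv _ ((isUnit_iff_isUnit_det _).1 hS), one_mulVec]
  have hval : ∀ k (hk : k < n), (u ᵥ* C) ⬝ᵥ (M ^ k *ᵥ v) = if k = n - 1 then 1 else 0 := by
    intro k hk
    rw [dotProduct_mulVec]
    exact (congrFun hSv ⟨k, hk⟩).trans (by simp [Pi.single_apply])
  refine ⟨L + vecMulVec (aeval M p *ᵥ v) u, ?_⟩
  rw [Matrix.add_mul, ← sub_sub, ← hM, vecMulVec_mul]
  refine charpoly_sub_vecMulVec_aeval M (u ᵥ* C) v (fun k hk => ?_) ?_ hp hdeg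
  · rw [hval k (by omega), if_neg (by omega)]
  · rw [hval _ (by omega), if_pos rfl]

theorem stmt1 {n q : ℕ} (hn : 1 ≤ n)
    (A : Matrix (Fin n) (Fin n) ℝ) (C : Matrix (Fin q) (Fin n) ℝ) :
    (∀ p : ℝ[X], p.Monic → p.natDegree = n →
      ∃ L : Matrix (Fin n) (Fin q) ℝ, (A - L * C).charpoly = p) ↔
    IsObservable A C :=
  ⟨isObservable_of_forall_exists_charpoly_eq, fun h _ hp hdeg => h.exists_charpoly_eq hn hp hdeg⟩
end

section
/- Let n, q ≥ 1, A ∈ ℝ^{n×n}, C ∈ ℝ^{q×n}, let V ∈ ℝ^{q×q} be symmetric positive definite and W ∈ ℝ^{n×n} be symmetric positive semidefinite. Suppose the pair (A, C) is observable and S ∈ ℝ^{n×n} is symmetric positive definite and satisfies the Riccati equation A·S + S·Aᵀ − S·Cᵀ·V⁻¹·C·S = −W. Then, with L = S·Cᵀ·V⁻¹, the matrix A − L·C is Hurwitz. -/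
open Matrix

/-- The real and imaginary parts `x`, `y` of an eigenvector for a complex root `z` of the
characteristic polynomial of a real matrix. -/
theorem Matrix.exists_re_im_eigenvector {ι : Type*} [Fintype ι] [DecidableEq ι]
    (M : Matrix ι ι ℝ) {z : ℂ} (hz : (M.charpoly.map (algebraMap ℝ ℂ)).IsRoot z) :
    ∃ x y : ι → ℝ, (x ≠ 0 ∨ y ≠ 0) ∧ M *ᵥ x = z.re • x - z.im • y ∧
      M *ᵥ y = z.im • x + z.re • y := by
  rw [← Matrix.charpoly_map, Polynomial.IsRoot, Matrix.eval_charpoly,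
    ← Matrix.exists_mulVec_eq_zero_iff] at hz
  obtain ⟨v, hv, h⟩ := hz
  have key : ∀ i, ∑ j, (M i j : ℂ) * v j = z * v i := by
    intro i
    have hi := congrFun h i
    simp only [sub_mulVec, Pi.sub_apply, Pi.zero_apply, sub_eq_zero, scalar_apply,
      mulVec_diagonal] at hi
    exact hi.symm
  refine ⟨fun i => (v i).re, fun i => (v i).im, ?_, ?_, ?_⟩
  · by_contra! hxy
    exact hv (funext fun i => Complex.ext (congrFun hxy.1 i) (congrFun hxy.2 i))
  · ext i
    have := congrArg Complex.re (key i)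
    simpa [mulVec, dotProduct] using this
  · ext i
    have := congrArg Complex.im (key i)
    simp [mulVec, dotProduct] at this ⊢
    linarith

/-- Two vectors annihilated by `C` that span an `A`-invariant subspace are unobservable. -/
theorem IsObservable.eq_zero_and_eq_zero {n q : ℕ} {A : Matrix (Fin n) (Fin n) ℝ}
    {C : Matrix (Fin q) (Fin n) ℝ} (h : IsObservable A C) {x y : Fin n → ℝ} {a b c d : ℝ}
    (hCx : C *ᵥ x = 0) (hCy : C *ᵥ y = 0) (hAx : A *ᵥ x = a • x + b • y)
    (hAy : A *ᵥ y = c • x + d • y) : x = 0 ∧ y = 0 := by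
  have key : ∀ k, C *ᵥ (A ^ k *ᵥ x) = 0 ∧ C *ᵥ (A ^ k *ᵥ y) = 0 := by
    intro k
    induction k with
    | zero => simp [hCx, hCy]
    | succ k ih =>
      rw [pow_succ, ← mulVec_mulVec, ← mulVec_mulVec, hAx, hAy]
      simp [mulVec_add, mulVec_smul, ih.1, ih.2]
  exact ⟨h x fun k _ => (key k).1, h y fun k _ => (key k).2⟩

theorem stmt2 {n q : ℕ} (hn : 1 ≤ n) (hq : 1 ≤ q)
    (A : Matrix (Fin n) (Fin n) ℝ) (C : Matrix (Fin q) (Fin n) ℝ)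
    (V : Matrix (Fin q) (Fin q) ℝ) (W : Matrix (Fin n) (Fin n) ℝ)
    (hV : V.PosDef) (hW : W.PosSemidef)
    (hobs : IsObservable A C)
    (S : Matrix (Fin n) (Fin n) ℝ) (hS : S.PosDef)
    (hRiccati : A * S + S * Aᵀ - S * Cᵀ * V⁻¹ * C * S = -W) :
    IsHurwitz (A - (S * Cᵀ * V⁻¹) * C) := by
  intro z hz
  set M := A - S * Cᵀ * V⁻¹ * C with hM
  obtain ⟨x, y, hxy, hx, hy⟩ := M.exists_re_im_eigenvector hz
  have hSt : Sᵀ = S := by simpa [IsSymm] using hS.isHermitian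
  have hVi : V⁻¹.PosDef := hV.inv
  have hVit : V⁻¹ᵀ = V⁻¹ := by simpa [IsSymm] using hVi.isHermitian
  have hSdet : IsUnit S.det := (Matrix.isUnit_iff_isUnit_det S).mp hS.isUnit
  have hlyap : M * S + S * Mᵀ = -W - (C * S)ᵀ * V⁻¹ * (C * S) := by
    simp only [hM, transpose_sub, transpose_mul, transpose_transpose, hSt, hVit, Matrix.sub_mul,
      Matrix.mul_sub, ← Matrix.mul_assoc]
    rw [← hRiccati]
    abel
  have hquad : ∀ u : Fin n → ℝ, 2 * (u ⬝ᵥ M *ᵥ (S *ᵥ u)) =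
      -(u ⬝ᵥ W *ᵥ u) - (C *ᵥ (S *ᵥ u)) ⬝ᵥ V⁻¹ *ᵥ (C *ᵥ (S *ᵥ u)) := by
    intro u
    have h := congrArg (fun N => u ⬝ᵥ N *ᵥ u) hlyap
    have h1 : u ⬝ᵥ (S * Mᵀ) *ᵥ u = u ⬝ᵥ M *ᵥ (S *ᵥ u) := by
      rw [mulVec_mulVec, dotProduct_mulVec, ← mulVec_transpose, dotProduct_comm]
      simp [transpose_mul, hSt]
    have h2 : u ⬝ᵥ ((C * S)ᵀ * V⁻¹ * (C * S)) *ᵥ u =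
        (C *ᵥ (S *ᵥ u)) ⬝ᵥ V⁻¹ *ᵥ (C *ᵥ (S *ᵥ u)) := by
      rw [← mulVec_mulVec, ← mulVec_mulVec, dotProduct_mulVec, vecMul_transpose,
        ← mulVec_mulVec]
    simp only [add_mulVec, sub_mulVec, neg_mulVec, dotProduct_add, dotProduct_sub,
      dotProduct_neg, h1, h2, ← mulVec_mulVec (M := M) (N := S)] at h
    linarith
  have hsurj : ∀ v : Fin n → ℝ, ∃ u, S *ᵥ u = v := fun v =>
    ⟨S⁻¹ *ᵥ v, by rw [mulVec_mulVec, Matrix.mul_nonsing_inv _ hSdet, one_mulVec]⟩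
  obtain ⟨u, rfl⟩ := hsurj x
  obtain ⟨w, rfl⟩ := hsurj y
  have hWnn : ∀ v : Fin n → ℝ, 0 ≤ v ⬝ᵥ W *ᵥ v := fun v => by
    simpa using hW.dotProduct_mulVec_nonneg v
  have hSnn : ∀ v : Fin n → ℝ, 0 ≤ v ⬝ᵥ S *ᵥ v := fun v => by
    simpa using hS.posSemidef.dotProduct_mulVec_nonneg v
  have hVnn : ∀ v : Fin q → ℝ, 0 ≤ v ⬝ᵥ V⁻¹ *ᵥ v := fun v => by
    simpa using hVi.posSemidef.dotProduct_mulVec_nonneg v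
  have hVzero : ∀ v : Fin q → ℝ, v ⬝ᵥ V⁻¹ *ᵥ v ≤ 0 → v = 0 := fun v hv => by
    by_contra hne
    have := hVi.dotProduct_mulVec_pos hne
    simp only [star_trivial] at this
    linarith
  have hsymm : w ⬝ᵥ S *ᵥ u = u ⬝ᵥ S *ᵥ w := by
    rw [dotProduct_mulVec, ← mulVec_transpose, hSt, dotProduct_comm]
  have hqu := hquad u
  have hqw := hquad w
  rw [hx] at hqu
  rw [hy] at hqw
  simp only [dotProduct_add, dotProduct_sub, dotProduct_smul, smul_eq_mul, hsymm] at hqu hqw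
  by_contra! hre
  have hu := mul_nonneg hre (hSnn u)
  have hw := mul_nonneg hre (hSnn w)
  have hCx : C *ᵥ (S *ᵥ u) = 0 := hVzero _ (by
    linarith [hWnn u, hWnn w, hVnn (C *ᵥ (S *ᵥ w))])
  have hCy : C *ᵥ (S *ᵥ w) = 0 := hVzero _ (by
    linarith [hWnn u, hWnn w, hVnn (C *ᵥ (S *ᵥ u))])
  have hMA : ∀ v, C *ᵥ v = 0 → M *ᵥ v = A *ᵥ v := fun v hv => by
    rw [hM, sub_mulVec, ← mulVec_mulVec (N := C), hv, mulVec_zero, sub_zero]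
  rw [hMA _ hCx, sub_eq_add_neg, ← neg_smul] at hx
  rw [hMA _ hCy] at hy
  obtain ⟨h0, h1⟩ := hobs.eq_zero_and_eq_zero hCx hCy hx hy
  exact hxy.elim (· h0) (· h1)
end

section
/- Let N ≥ 1, let Ã ∈ ℝ^{N×N} be Hurwitz, and let Q̃ ∈ ℝ^{N×N} be symmetric positive definite. Then there exists a unique matrix P̃ ∈ ℝ^{N×N} satisfying the Lyapunov equation ÃᵀP̃ + P̃Ã + Q̃ = 0, and moreover this P̃ is symmetric and positive definite. -/
open Matrix

open Filter Topology

/-- Powers of an element of a complex Banach algebra with spectrum in the open unit disc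
tend to zero. -/
theorem tendsto_pow_zero_of_spectrum_lt_one {R : Type*} [NormedRing R] [NormedAlgebra ℂ R]
    [CompleteSpace R] [Nontrivial R] {a : R} (h : ∀ z ∈ spectrum ℂ a, ‖z‖ < 1) :
    Tendsto (fun n : ℕ => a ^ n) atTop (𝓝 0) := by
  have hr : spectralRadius ℂ a < ((1 : NNReal) : ENNReal) :=
    spectrum.spectralRadius_lt_of_forall_lt a (fun z hz => by exact_mod_cast h z hz)
  obtain ⟨r, har, hr1⟩ := ENNReal.lt_iff_exists_nnreal_btwn.1 hr
  have hlt : r < 1 := by exact_mod_cast hr1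
  refine squeeze_zero_norm' (a := fun n : ℕ => (r : ℝ) ^ n) ?_
    (tendsto_pow_atTop_nhds_zero_of_lt_one r.2 (by exact_mod_cast hlt))
  filter_upwards [(spectrum.pow_nnnorm_pow_one_div_tendsto_nhds_spectralRadius a).eventually
    (gt_mem_nhds har), eventually_gt_atTop 0] with n hn hn0
  have hpos : (0 : ℝ) < n := by exact_mod_cast hn0
  have := ENNReal.rpow_le_rpow hn.le hpos.le
  rw [← ENNReal.rpow_mul, one_div_mul_cancel hpos.ne', ENNReal.rpow_one,
    ENNReal.rpow_natCast] at this
  exact_mod_cast this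

section

variable {ι : Type*} [Fintype ι] [DecidableEq ι]

theorem IsHurwitz.isUnit_sub {A : Matrix ι ι ℝ} (hA : IsHurwitz A) {z : ℂ} (hz : 0 ≤ z.re) :
    IsUnit (algebraMap ℂ (Matrix ι ι ℂ) z - A.map (algebraMap ℝ ℂ)) := by
  rw [Matrix.isUnit_iff_isUnit_det, isUnit_iff_ne_zero]
  intro h
  refine (hA z ?_).not_ge hz
  rw [← Matrix.charpoly_map, Polynomial.IsRoot, Matrix.eval_charpoly]
  exact h

theorem IsHurwitz.isUnit_one_sub {A : Matrix ι ι ℝ} (hA : IsHurwitz A) : IsUnit (1 - A) := by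
  have h := hA.isUnit_sub (z := 1) (by simp)
  rw [Matrix.isUnit_iff_isUnit_det, isUnit_iff_ne_zero] at h ⊢
  intro h0
  apply h
  have := (algebraMap ℝ ℂ).map_det (1 - A)
  rw [h0, map_zero, map_sub, map_one] at this
  rw [map_one]
  exact this.symm

/-- The Cayley transform of a square matrix. -/
noncomputable def cayleyTransform (A : Matrix ι ι ℝ) : Matrix ι ι ℝ := (1 + A) * (1 - A)⁻¹

theorem cayleyTransform_mul_one_sub {A : Matrix ι ι ℝ} (hA : IsHurwitz A) :
    cayleyTransform A * (1 - A) = 1 + A := by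
  rw [cayleyTransform, Matrix.mul_assoc,
    Matrix.nonsing_inv_mul _ ((Matrix.isUnit_iff_isUnit_det _).1 hA.isUnit_one_sub),
    Matrix.mul_one]

theorem norm_lt_one_of_mem_spectrum_cayleyTransform {A : Matrix ι ι ℝ} (hA : IsHurwitz A)
    {z : ℂ} (hz : z ∈ spectrum ℂ ((cayleyTransform A).map (algebraMap ℝ ℂ))) : ‖z‖ < 1 := by
  by_contra! hn
  rw [spectrum.mem_iff] at hz
  apply hz
  set B := A.map (algebraMap ℝ ℂ) with hB
  set C := (cayleyTransform A).map (algebraMap ℝ ℂ) with hC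
  have hCB : C * (1 - B) = 1 + B := by
    have h := congrArg (algebraMap ℝ ℂ).mapMatrix (cayleyTransform_mul_one_sub hA)
    rwa [map_mul, map_sub, map_add, map_one] at h
  have key : (algebraMap ℂ (Matrix ι ι ℂ) z - C) * (1 - B) = (z - 1) • 1 - (z + 1) • B := by
    rw [sub_mul, hCB, Algebra.algebraMap_eq_smul_one]
    simp only [smul_mul_assoc, one_mul, smul_sub, sub_smul, add_smul, one_smul]
    abel
  suffices h : IsUnit ((z - 1) • (1 : Matrix ι ι ℂ) - (z + 1) • B) by
    rw [← key, Matrix.isUnit_iff_isUnit_det, Matrix.det_mul] at h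
    exact (Matrix.isUnit_iff_isUnit_det _).2 (isUnit_of_mul_isUnit_left h)
  by_cases h1 : z + 1 = 0
  · have h2 : z - 1 ≠ 0 := by
      intro h2
      have : (2 : ℂ) = 0 := by linear_combination h1 - h2
      norm_num at this
    rw [h1, zero_smul, sub_zero]
    exact (isUnit_one (M := Matrix ι ι ℂ)).smul (Units.mk0 _ h2)
  · have hre : 0 ≤ ((z - 1) / (z + 1)).re := by
      have hsq : 1 ≤ z.re * z.re + z.im * z.im := by
        rw [← Complex.normSq_apply, Complex.normSq_eq_norm_sq]
        exact one_le_pow₀ hn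
      rw [Complex.div_re, ← add_div]
      refine div_nonneg ?_ (Complex.normSq_nonneg _)
      simp
      nlinarith
    have h := (hA.isUnit_sub hre).smul (Units.mk0 _ h1)
    convert h using 1
    rw [Units.smul_mk0, smul_sub, Algebra.algebraMap_eq_smul_one, smul_smul, mul_div_cancel₀ _ h1]

theorem tendsto_cayleyTransform_pow [Nonempty ι] {A : Matrix ι ι ℝ} (hA : IsHurwitz A) :
    Tendsto (fun n : ℕ => cayleyTransform A ^ n) atTop (𝓝 0) := by
  let _ : NormedRing (Matrix ι ι ℂ) := Matrix.linftyOpNormedRing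
  let _ : NormedAlgebra ℂ (Matrix ι ι ℂ) := Matrix.linftyOpNormedAlgebra
  have h : Tendsto (fun n : ℕ => (cayleyTransform A).map (algebraMap ℝ ℂ) ^ n) atTop (𝓝 0) :=
    tendsto_pow_zero_of_spectrum_lt_one
      fun z hz => norm_lt_one_of_mem_spectrum_cayleyTransform hA hz
  have hre := ((continuous_id.matrix_map Complex.continuous_re).tendsto
    (0 : Matrix ι ι ℂ)).comp h
  convert hre using 1
  · funext n
    have := map_pow (algebraMap ℝ ℂ).mapMatrix (cayleyTransform A) n
    simp only [RingHom.mapMatrix_apply] at this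
    simp only [Function.comp, ← this]
    ext i j
    simp
  · simp

theorem sub_transpose_mul_cayleyTransform {A : Matrix ι ι ℝ} (hA : IsHurwitz A)
    (X : Matrix ι ι ℝ) :
    (1 - A)ᵀ * (X - (cayleyTransform A)ᵀ * X * cayleyTransform A) * (1 - A) =
      -(2 : ℝ) • (Aᵀ * X + X * A) := by
  have h := cayleyTransform_mul_one_sub hA
  have ht : (1 - A)ᵀ * (cayleyTransform A)ᵀ = (1 + A)ᵀ := by rw [← Matrix.transpose_mul, h]
  calc _ = (1 - A)ᵀ * X * (1 - A) -
        ((1 - A)ᵀ * (cayleyTransform A)ᵀ) * X * (cayleyTransform A * (1 - A)) := by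
        noncomm_ring
    _ = _ := by
        rw [h, ht, Matrix.transpose_add, Matrix.transpose_sub, Matrix.transpose_one, neg_smul,
          two_smul]
        noncomm_ring

theorem eq_zero_of_eq_transpose_mul_mul {C X : Matrix ι ι ℝ}
    (hC : Tendsto (fun n : ℕ => C ^ n) atTop (𝓝 0)) (h : X = Cᵀ * X * C) : X = 0 := by
  have hX : ∀ n : ℕ, (C ^ n)ᵀ * X * C ^ n = X := by
    intro n
    induction n with
    | zero => simp
    | succ n ih =>
      calc _ = (C ^ n)ᵀ * (Cᵀ * X * C) * C ^ n := by
            rw [pow_succ', Matrix.transpose_mul]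
            simp only [Matrix.mul_assoc]
        _ = X := by rw [← h, ih]
  have hlim : Tendsto (fun n : ℕ => (C ^ n)ᵀ * X * C ^ n) atTop (𝓝 (0ᵀ * X * 0)) :=
    (((continuous_id.matrix_transpose.tendsto _).comp hC).mul_const X).mul hC
  simp only [hX, Matrix.mul_zero] at hlim
  exact tendsto_nhds_unique tendsto_const_nhds hlim

theorem posDef_of_posDef_sub {C P : Matrix ι ι ℝ}
    (hC : Tendsto (fun n : ℕ => C ^ n) atTop (𝓝 0)) (hP : P.IsHermitian)
    (hR : (P - Cᵀ * P * C).PosDef) : P.PosDef := by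
  have hV : ∀ x : ι → ℝ, x ⬝ᵥ P *ᵥ x =
      (C *ᵥ x) ⬝ᵥ P *ᵥ (C *ᵥ x) + x ⬝ᵥ (P - Cᵀ * P * C) *ᵥ x := by
    intro x
    have : (C *ᵥ x) ⬝ᵥ P *ᵥ (C *ᵥ x) = x ⬝ᵥ (Cᵀ * P * C) *ᵥ x := by
      rw [Matrix.mul_assoc, ← Matrix.mulVec_mulVec, Matrix.dotProduct_mulVec x,
        Matrix.vecMul_transpose, Matrix.mulVec_mulVec]
    rw [this, Matrix.sub_mulVec, dotProduct_sub]
    ring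
  have hnonneg : ∀ x : ι → ℝ, 0 ≤ x ⬝ᵥ P *ᵥ x := by
    intro x
    have hanti : Antitone fun n : ℕ => (C ^ n *ᵥ x) ⬝ᵥ P *ᵥ (C ^ n *ᵥ x) := by
      refine antitone_nat_of_succ_le fun n => ?_
      have := hR.posSemidef.dotProduct_mulVec_nonneg (C ^ n *ᵥ x)
      rw [star_trivial] at this
      rw [hV (C ^ n *ᵥ x), Matrix.mulVec_mulVec x C, ← pow_succ']
      linarith
    have hcont : Continuous fun M : Matrix ι ι ℝ => (M *ᵥ x) ⬝ᵥ P *ᵥ (M *ᵥ x) := by fun_prop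
    have hlim := (hcont.tendsto 0).comp hC
    have := hanti.le_of_tendsto hlim 0
    simpa using this
  refine Matrix.PosDef.of_dotProduct_mulVec_pos hP fun x hx => ?_
  have := hR.dotProduct_mulVec_pos hx
  rw [star_trivial] at this ⊢
  rw [hV]
  linarith [hnonneg (C *ᵥ x)]

theorem IsHurwitz.eq_zero_of_lyapunov [Nonempty ι] {A X : Matrix ι ι ℝ} (hA : IsHurwitz A)
    (h : Aᵀ * X + X * A = 0) : X = 0 := by
  refine eq_zero_of_eq_transpose_mul_mul (tendsto_cayleyTransform_pow hA) (sub_eq_zero.1 ?_)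
  have key := sub_transpose_mul_cayleyTransform hA X
  rw [h, smul_zero] at key
  have hu := hA.isUnit_one_sub
  exact ((Matrix.isUnit_transpose _).2 hu).mul_right_eq_zero.1 (hu.mul_left_eq_zero.1 key)

theorem IsHurwitz.posDef_of_lyapunov [Nonempty ι] {A P Q : Matrix ι ι ℝ} (hA : IsHurwitz A)
    (hQ : Q.PosDef) (h : Aᵀ * P + P * A + Q = 0) : P.PosDef := by
  have hQt : Qᵀ = Q := by simpa using hQ.isHermitian.eq
  have hP : P.IsHermitian := by
    have ht : Aᵀ * Pᵀ + Pᵀ * A + Q = 0 := by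
      have := congrArg Matrix.transpose h
      simp only [Matrix.transpose_add, Matrix.transpose_mul, Matrix.transpose_transpose,
        Matrix.transpose_zero, hQt] at this
      rwa [add_comm (Aᵀ * Pᵀ)]
    have : Pᵀ - P = 0 := hA.eq_zero_of_lyapunov <| by
      calc _ = (Aᵀ * Pᵀ + Pᵀ * A + Q) - (Aᵀ * P + P * A + Q) := by noncomm_ring
        _ = 0 := by rw [ht, h, sub_zero]
    rw [Matrix.IsHermitian, Matrix.conjTranspose_eq_transpose_of_trivial]
    exact sub_eq_zero.1 this
  refine posDef_of_posDef_sub (tendsto_cayleyTransform_pow hA) hP ?_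
  rw [← Matrix.IsUnit.posDef_star_left_conjugate_iff hA.isUnit_one_sub, Matrix.star_eq_conjTranspose,
    Matrix.conjTranspose_eq_transpose_of_trivial, sub_transpose_mul_cayleyTransform hA,
    eq_neg_of_add_eq_zero_left h, smul_neg, neg_smul, neg_neg]
  exact hQ.smul two_pos

theorem IsHurwitz.existsUnique_lyapunov [Nonempty ι] {A : Matrix ι ι ℝ} (hA : IsHurwitz A)
    (Q : Matrix ι ι ℝ) : ∃! P : Matrix ι ι ℝ, Aᵀ * P + P * A + Q = 0 := by
  let L : Matrix ι ι ℝ →ₗ[ℝ] Matrix ι ι ℝ := LinearMap.mulLeft ℝ Aᵀ + LinearMap.mulRight ℝ A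
  have hL : ∀ X, L X = Aᵀ * X + X * A := fun _ => rfl
  have hinj : Function.Injective L :=
    (injective_iff_map_eq_zero L).2 fun X hX => hA.eq_zero_of_lyapunov hX
  have hbij : Function.Bijective L := ⟨hinj, LinearMap.injective_iff_surjective.1 hinj⟩
  simpa only [hL, eq_neg_iff_add_eq_zero] using hbij.existsUnique (-Q)

end

theorem stmt5 {N : ℕ} (hN : 1 ≤ N)
    (Atil : Matrix (Fin N) (Fin N) ℝ) (hA : IsHurwitz Atil)
    (Qtil : Matrix (Fin N) (Fin N) ℝ) (hQ : Qtil.PosDef) :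
    (∃! Ptil : Matrix (Fin N) (Fin N) ℝ,
        Atilᵀ * Ptil + Ptil * Atil + Qtil = 0) ∧
    ∀ Ptil : Matrix (Fin N) (Fin N) ℝ,
      Atilᵀ * Ptil + Ptil * Atil + Qtil = 0 → Ptil.PosDef := by
  have : Nonempty (Fin N) := ⟨⟨0, hN⟩⟩
  exact ⟨hA.existsUnique_lyapunov Qtil, fun _ h => hA.posDef_of_lyapunov hQ h⟩
end

section
/- Let α > 0, γ > 0, and a < b be real numbers. Let θ : ℝ → ℝ be differentiable on [a, b] with θ(a) = 0, θ(t) ≥ 0 for all t ∈ [a, b], and θ′(t) ≤ γ + α·(1 + θ(t))² for all t ∈ [a, b]. Then √(α·γ)·(b − a) ≥ arctan(√(α/γ)·(1 + θ(b))) − arctan(√(α/γ)). -/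
theorem stmt11 (α γ : ℝ) (hα : 0 < α) (hγ : 0 < γ)
    (a b : ℝ) (hab : a < b) (θ θ' : ℝ → ℝ)
    (hderiv : ∀ t ∈ Set.Icc a b, HasDerivAt θ (θ' t) t)
    (ha : θ a = 0) (hnonneg : ∀ t ∈ Set.Icc a b, 0 ≤ θ t)
    (hineq : ∀ t ∈ Set.Icc a b, θ' t ≤ γ + α * (1 + θ t) ^ 2) :
    Real.sqrt (α * γ) * (b - a) ≥
      Real.arctan (Real.sqrt (α / γ) * (1 + θ b)) - Real.arctan (Real.sqrt (α / γ)) := by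
  have hc : √(α / γ) ^ 2 = α / γ := Real.sq_sqrt (by positivity)
  have hs : √(α * γ) = √(α / γ) * γ := by
    rw [show α * γ = α / γ * γ ^ 2 by field_simp, Real.sqrt_mul (by positivity),
      Real.sqrt_sq hγ.le]
  rw [hs]
  set c := √(α / γ)
  have hc0 : 0 ≤ c := Real.sqrt_nonneg _
  have hf : ∀ t ∈ Set.Icc a b, HasDerivAt (fun t ↦ Real.arctan (c * (1 + θ t)))
      (1 / (1 + (c * (1 + θ t)) ^ 2) * (c * θ' t)) t := fun t ht ↦
    (((hderiv t ht).const_add 1).const_mul c).arctan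
  have hB : ∀ t, HasDerivAt (fun t ↦ Real.arctan c + c * γ * (t - a)) (c * γ) t := fun t ↦ by
    simpa using (((hasDerivAt_id t).sub_const a).const_mul (c * γ)).const_add (Real.arctan c)
  have key := image_le_of_deriv_right_le_deriv_boundary
    (fun t ht ↦ (hf t ht).continuousAt.continuousWithinAt)
    (fun t ht ↦ (hf t (Set.Ico_subset_Icc_self ht)).hasDerivWithinAt)
    (by simp [ha])
    (fun t _ ↦ (hB t).continuousAt.continuousWithinAt)
    (fun t _ ↦ (hB t).hasDerivWithinAt)
    (fun t ht ↦ by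
      rw [one_div_mul_eq_div, div_le_iff₀ (by positivity)]
      calc c * θ' t ≤ c * (γ + α * (1 + θ t) ^ 2) :=
            mul_le_mul_of_nonneg_left (hineq t (Set.Ico_subset_Icc_self ht)) hc0
        _ = c * γ * (1 + (c * (1 + θ t)) ^ 2) := by
            rw [mul_pow, hc]
            field_simp)
    (Set.right_mem_Icc.mpr hab.le)
  linarith
end

section
/- Let α > 0, γ > 0, σ ∈ (0, 1), let Q̃ ∈ ℝ^{N×N} be symmetric positive definite, and let P̃ ∈ ℝ^{N×N} be nonzero with operator norm ‖P̃‖. Define c = (1 − σ)·λ_min(Q̃)/(2·‖P̃‖) and τ = (arctan(√(α/γ)·(1 + c)) − arctan(√(α/γ)))/√(α·γ). Then τ > 0, and for any a < b and any θ : ℝ → ℝ differentiable on [a, b] with θ(a) = 0, θ ≥ 0 on [a, b], θ′(t) ≤ γ + α·(1 + θ(t))² on [a, b], and θ(b) ≥ c, one has b − a ≥ τ. In particular, consecutive event times satisfying these conditions are separated by at least the positive constant τ, excluding Zeno behavior. -/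
open Matrix

/-- The operator norm of a real square matrix, induced by the Euclidean norm. -/
noncomputable def l2OpNorm {ι : Type*} [Fintype ι] [DecidableEq ι]
    (M : Matrix ι ι ℝ) : ℝ :=
  ‖Matrix.toEuclideanCLM (𝕜 := ℝ) M‖

/-- A nonzero matrix has positive operator norm. -/
theorem l2OpNorm_pos {ι : Type*} [Fintype ι] [DecidableEq ι] {M : Matrix ι ι ℝ} (hM : M ≠ 0) :
    0 < l2OpNorm M := by
  rw [l2OpNorm, norm_pos_iff]
  exact (map_ne_zero_iff _ (Matrix.toEuclideanCLM (n := ι) (𝕜 := ℝ)).injective).2 hM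

/-- The smallest eigenvalue of a positive definite matrix is positive. -/
theorem Matrix.PosDef.iInf_eigenvalues_pos {ι : Type*} [Fintype ι] [DecidableEq ι] [Nonempty ι]
    {M : Matrix ι ι ℝ} (hM : M.PosDef) : 0 < ⨅ i, hM.1.eigenvalues i := by
  obtain ⟨i, hi⟩ := exists_eq_ciInf_of_finite (f := hM.1.eigenvalues)
  exact hi ▸ hM.eigenvalues_pos i

/-- If `u' ≤ γ + α u ^ 2` on `[a, b]`, then `arctan (√(α / γ) * u)` grows at rate at most
`√(α * γ)`. -/
theorem arctan_sub_arctan_le_of_riccati {α γ : ℝ} (hα : 0 < α) (hγ : 0 < γ) {a b : ℝ}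
    (hab : a ≤ b) {u u' : ℝ → ℝ} (hu : ∀ t ∈ Set.Icc a b, HasDerivAt u (u' t) t)
    (hle : ∀ t ∈ Set.Icc a b, u' t ≤ γ + α * u t ^ 2) :
    Real.arctan (√(α / γ) * u b) - Real.arctan (√(α / γ) * u a) ≤ √(α * γ) * (b - a) := by
  have hderiv : ∀ t ∈ Set.Icc a b, HasDerivAt (fun t => Real.arctan (√(α / γ) * u t))
      (1 / (1 + (√(α / γ) * u t) ^ 2) * (√(α / γ) * u' t)) t := fun t ht =>
    ((hu t ht).const_mul _).arctan
  have hsqrt : √(α * γ) = √(α / γ) * γ := by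
    rw [show α * γ = α / γ * γ ^ 2 by field_simp, Real.sqrt_mul (by positivity),
      Real.sqrt_sq hγ.le]
  refine (convex_Icc a b).image_sub_le_mul_sub_of_deriv_le
    (fun t ht => (hderiv t ht).continuousAt.continuousWithinAt)
    (fun t ht => (hderiv t (interior_subset ht)).differentiableAt.differentiableWithinAt)
    (fun t ht => ?_) a (Set.left_mem_Icc.2 hab) b (Set.right_mem_Icc.2 hab) hab
  have ht := interior_subset ht
  rw [(hderiv t ht).deriv, one_div_mul_eq_div, div_le_iff₀ (by positivity), hsqrt, mul_pow,
    Real.sq_sqrt (by positivity), mul_assoc]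
  gcongr
  calc u' t ≤ γ + α * u t ^ 2 := hle t ht
    _ = γ * (1 + α / γ * u t ^ 2) := by field_simp

theorem stmt13 {N : ℕ} (hN : 1 ≤ N)
    (α γ : ℝ) (hα : 0 < α) (hγ : 0 < γ)
    (σ : ℝ) (hσ : σ ∈ Set.Ioo (0 : ℝ) 1)
    (Qtil : Matrix (Fin N) (Fin N) ℝ) (hQ : Qtil.PosDef)
    (Ptil : Matrix (Fin N) (Fin N) ℝ) (hPtil : Ptil ≠ 0) :
    (0 <
      (Real.arctan (Real.sqrt (α / γ) *
          (1 + (1 - σ) * (⨅ i, hQ.1.eigenvalues i) / (2 * l2OpNorm Ptil))) -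
        Real.arctan (Real.sqrt (α / γ))) / Real.sqrt (α * γ)) ∧
    ∀ (a b : ℝ), a < b → ∀ θ θ' : ℝ → ℝ,
      (∀ t ∈ Set.Icc a b, HasDerivAt θ (θ' t) t) →
      θ a = 0 →
      (∀ t ∈ Set.Icc a b, 0 ≤ θ t) →
      (∀ t ∈ Set.Icc a b, θ' t ≤ γ + α * (1 + θ t) ^ 2) →
      (1 - σ) * (⨅ i, hQ.1.eigenvalues i) / (2 * l2OpNorm Ptil) ≤ θ b →
      (Real.arctan (Real.sqrt (α / γ) *
          (1 + (1 - σ) * (⨅ i, hQ.1.eigenvalues i) / (2 * l2OpNorm Ptil))) -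
        Real.arctan (Real.sqrt (α / γ))) / Real.sqrt (α * γ) ≤ b - a := by
  have : Nonempty (Fin N) := ⟨⟨0, hN⟩⟩
  have hc : 0 < (1 - σ) * (⨅ i, hQ.1.eigenvalues i) / (2 * l2OpNorm Ptil) :=
    div_pos (mul_pos (sub_pos.2 hσ.2) hQ.iInf_eigenvalues_pos)
      (mul_pos two_pos (l2OpNorm_pos hPtil))
  generalize (1 - σ) * (⨅ i, hQ.1.eigenvalues i) / (2 * l2OpNorm Ptil) = c at hc ⊢
  have hs : 0 < √(α / γ) := by positivity
  refine ⟨div_pos (sub_pos.2 (Real.arctan_strictMono ?_)) (by positivity), ?_⟩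
  · exact lt_mul_of_one_lt_right hs (by linarith)
  · intro a b hab θ θ' hθ ha _ hle hb
    have hgrowth := arctan_sub_arctan_le_of_riccati hα hγ hab.le
      (fun t ht => (hθ t ht).const_add 1) hle
    have hmono : Real.arctan (√(α / γ) * (1 + c)) ≤ Real.arctan (√(α / γ) * (1 + θ b)) :=
      Real.arctan_mono (by gcongr)
    rw [ha, add_zero, mul_one] at hgrowth
    rw [div_le_iff₀ (by positivity)]
    linarith
end
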